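/- arXiv:2510.01517 — 8 statements merged into one kernel-verified Lean document; each statement's English description precedes it below -/
import Mathlib

section
/- Let τ : 𝔤 → Hom(V, W) be a tableau map with image 𝔥 = range τ and n = dim V. Then dim 𝔤⁽¹⁾ = dim 𝔥⁽¹⁾ + n · dim(ker τ). -/
open Module Submodule

variable {𝔤 V W : Type} [AddCommGroup 𝔤] [Module ℝ 𝔤]
  [AddCommGroup V] [Module ℝ V] [AddCommGroup W] [Module ℝ W]

/-- The first prolongation `𝔤⁽¹⁾` of a tableau map `τ : 𝔤 → Hom(V, W)`:
the kernel of the Spencer differential. -/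
def tableauMapProlong (τ : 𝔤 →ₗ[ℝ] V →ₗ[ℝ] W) : Submodule ℝ (V →ₗ[ℝ] 𝔤) where
  carrier := {ξ | ∀ v w, τ (ξ v) w = τ (ξ w) v}
  add_mem' := by
    intro a b ha hb v w
    simp only [LinearMap.add_apply, map_add]
    rw [ha v w, hb v w]
  zero_mem' := by intro v w; simp
  smul_mem' := by
    intro c a ha v w
    simp only [LinearMap.smul_apply, map_smul]
    rw [ha v w]

/-- The first prolongation `𝔥⁽¹⁾` of a classical tableau `𝔥 ⊆ Hom(V, W)`,
realized as the symmetric `𝔥`-valued elements of `Hom(V, Hom(V, W))`. -/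
def tableauProlong (𝔥 : Submodule ℝ (V →ₗ[ℝ] W)) :
    Submodule ℝ (V →ₗ[ℝ] (V →ₗ[ℝ] W)) where
  carrier := {η | (∀ v, η v ∈ 𝔥) ∧ ∀ v w, η v w = η w v}
  add_mem' := by
    rintro a b ⟨ha1, ha2⟩ ⟨hb1, hb2⟩
    refine ⟨fun v => ?_, fun v w => ?_⟩
    · simpa using 𝔥.add_mem (ha1 v) (hb1 v)
    · simp only [LinearMap.add_apply]
      rw [ha2 v w, hb2 v w]
  zero_mem' := ⟨fun v => by simp, fun v w => by simp⟩
  smul_mem' := by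
    rintro c a ⟨ha1, ha2⟩
    refine ⟨fun v => ?_, fun v w => ?_⟩
    · simpa using 𝔥.smul_mem c (ha1 v)
    · simp only [LinearMap.smul_apply]
      rw [ha2 v w]

/-- Linear maps from `V` vanishing on a subspace `Vk ⊆ V`. -/
def vanishingOn (M : Type) [AddCommGroup M] [Module ℝ M] (Vk : Submodule ℝ V) :
    Submodule ℝ (V →ₗ[ℝ] M) where
  carrier := {ξ | ∀ v ∈ Vk, ξ v = 0}
  add_mem' := by
    intro a b ha hb v hv
    simp [ha v hv, hb v hv]
  zero_mem' := by intro v hv; simp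
  smul_mem' := by
    intro c a ha v hv
    simp [ha v hv]

/-- The `k`-th member `V_k = span(e₁, …, e_k)` of the flag associated to a basis. -/
def flagSub {n : ℕ} (e : Basis (Fin n) ℝ V) (k : ℕ) : Submodule ℝ V :=
  Submodule.span ℝ (e '' {i : Fin n | (i : ℕ) < k})

/-- The pushforward `τ_* : Hom(V, 𝔤) → Hom(V, Hom(V, W))`, `ξ ↦ τ ∘ ξ`. -/
def pushforward (τ : 𝔤 →ₗ[ℝ] V →ₗ[ℝ] W) :
    (V →ₗ[ℝ] 𝔤) →ₗ[ℝ] (V →ₗ[ℝ] (V →ₗ[ℝ] W)) :=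
  LinearMap.llcomp ℝ V 𝔤 (V →ₗ[ℝ] W) τ

theorem range_pushforward_domRestrict (τ : 𝔤 →ₗ[ℝ] V →ₗ[ℝ] W) :
    LinearMap.range ((pushforward τ).domRestrict (tableauMapProlong τ)) =
      tableauProlong (LinearMap.range τ) := by
  ext η
  constructor
  · rintro ⟨ξ, rfl⟩
    exact ⟨fun v => ⟨ξ.1 v, rfl⟩, ξ.2⟩
  · rintro ⟨hη, hsymm⟩
    obtain ⟨s, hs⟩ := τ.rangeRestrict.exists_rightInverse_of_surjective τ.range_rangeRestrict
    have hτ (v : V) : τ (s (η.codRestrict _ hη v)) = η v :=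
      congrArg Subtype.val (LinearMap.congr_fun hs (η.codRestrict _ hη v))
    refine ⟨⟨s ∘ₗ η.codRestrict _ hη, fun v w => ?_⟩, LinearMap.ext hτ⟩
    rw [LinearMap.comp_apply, LinearMap.comp_apply, hτ, hτ, hsymm]

/-- The kernel of `τ_*` on the first prolongation consists of the maps `V → ker τ`. -/
def kerPushforwardDomRestrictEquiv (τ : 𝔤 →ₗ[ℝ] V →ₗ[ℝ] W) :
    LinearMap.ker ((pushforward τ).domRestrict (tableauMapProlong τ)) ≃ₗ[ℝ]
      (V →ₗ[ℝ] LinearMap.ker τ) where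
  toFun ξ := ξ.1.1.codRestrict _ fun v => LinearMap.congr_fun ξ.2 v
  map_add' _ _ := rfl
  map_smul' _ _ := rfl
  invFun ζ := ⟨⟨(LinearMap.ker τ).subtype ∘ₗ ζ, fun v w => by simp⟩,
    LinearMap.ext fun v => (ζ v).2⟩
  left_inv _ := rfl
  right_inv _ := rfl

/-- `dim 𝔤⁽¹⁾ = dim 𝔥⁽¹⁾ + n · dim(ker τ)` where `n = dim V`. -/
theorem tableauMap_prolong_finrank
    [FiniteDimensional ℝ 𝔤] [FiniteDimensional ℝ V] [FiniteDimensional ℝ W]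
    (τ : 𝔤 →ₗ[ℝ] V →ₗ[ℝ] W) :
    finrank ℝ (tableauMapProlong τ) =
      finrank ℝ (tableauProlong (LinearMap.range τ)) +
        finrank ℝ V * finrank ℝ (LinearMap.ker τ) := by
  rw [← LinearMap.finrank_range_add_finrank_ker
      ((pushforward τ).domRestrict (tableauMapProlong τ)),
    range_pushforward_domRestrict, (kerPushforwardDomRestrictEquiv τ).finrank_eq,
    finrank_linearMap]
end

section
/- Let τ : 𝔤 → Hom(V, W) be a tableau map with image 𝔥 = range τ, and fix a basis e₁,…,e_n of V with V_k = span(e₁,…,e_k). For each 0 ≤ k ≤ n, the pushforward τ_* : ξ ↦ τ ∘ ξ maps (𝔤⁽¹⁾)_k onto (𝔥⁽¹⁾)_k, and the kernel of this restriction is {ξ ∈ Hom(V, ker τ) | ξ(v) = 0 for all v ∈ V_k}; consequently dim (𝔤⁽¹⁾)_k = dim (𝔥⁽¹⁾)_k + (n − k) · dim(ker τ). -/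
open Module Submodule

variable {𝔤 V W : Type} [AddCommGroup 𝔤] [Module ℝ 𝔤]
  [AddCommGroup V] [Module ℝ V] [AddCommGroup W] [Module ℝ W]

/-- The map sending `f : V ⧸ Vk → K`, with `K ⊆ M`, to the composite `V → V ⧸ Vk → K → M`. -/
def quotientHom {M : Type} [AddCommGroup M] [Module ℝ M] (Vk : Submodule ℝ V)
    (K : Submodule ℝ M) : ((V ⧸ Vk) →ₗ[ℝ] K) →ₗ[ℝ] (V →ₗ[ℝ] M) :=
  LinearMap.llcomp ℝ V K M K.subtype ∘ₗ LinearMap.lcomp ℝ K Vk.mkQ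

@[simp]
lemma quotientHom_apply {M : Type} [AddCommGroup M] [Module ℝ M] (Vk : Submodule ℝ V)
    (K : Submodule ℝ M) (f : (V ⧸ Vk) →ₗ[ℝ] K) (v : V) :
    quotientHom Vk K f v = f (Vk.mkQ v) := rfl

lemma quotientHom_injective {M : Type} [AddCommGroup M] [Module ℝ M] (Vk : Submodule ℝ V)
    (K : Submodule ℝ M) : Function.Injective (quotientHom Vk K) := by
  intro f g h
  ext v
  simpa using LinearMap.congr_fun h v

lemma mem_range_quotientHom {M : Type} [AddCommGroup M] [Module ℝ M] {Vk : Submodule ℝ V}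
    {K : Submodule ℝ M} {ξ : V →ₗ[ℝ] M} :
    ξ ∈ LinearMap.range (quotientHom Vk K) ↔ (∀ v, ξ v ∈ K) ∧ ∀ v ∈ Vk, ξ v = 0 := by
  constructor
  · rintro ⟨f, rfl⟩
    refine ⟨fun v => (f _).2, fun v hv => ?_⟩
    rw [quotientHom_apply, Submodule.mkQ_apply, (Submodule.Quotient.mk_eq_zero Vk).2 hv]
    simp
  · rintro ⟨hK, h0⟩
    refine ⟨Vk.liftQ (ξ.codRestrict K hK) fun v hv => ?_, ?_⟩
    · exact Subtype.ext (h0 v hv)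
    · ext v
      rfl

lemma finrank_flagSub {n : ℕ} (e : Basis (Fin n) ℝ V) {k : ℕ} (hk : k ≤ n) :
    finrank ℝ (flagSub e k) = k := by
  have hset : e '' {i : Fin n | (i : ℕ) < k} = Set.range (e ∘ Fin.castLE hk) := by
    rw [Set.range_comp, Fin.range_castLE]
  rw [flagSub, hset, finrank_span_eq_card
    (e.linearIndependent.comp _ (Fin.castLE_injective hk)), Fintype.card_fin]

lemma finrank_range_quotientHom_flagSub {M : Type} [AddCommGroup M] [Module ℝ M]
    [FiniteDimensional ℝ M] {n : ℕ} (e : Basis (Fin n) ℝ V) {k : ℕ} (hk : k ≤ n)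
    (K : Submodule ℝ M) :
    finrank ℝ (LinearMap.range (quotientHom (flagSub e k) K)) = (n - k) * finrank ℝ K := by
  have : FiniteDimensional ℝ V := e.finiteDimensional_of_finite
  rw [LinearMap.finrank_range_of_inj (quotientHom_injective _ _), finrank_linearMap,
    Submodule.finrank_quotient, finrank_flagSub e hk, finrank_eq_card_basis e, Fintype.card_fin]

lemma finrank_eq_finrank_map_add_finrank_inf_ker {E F : Type} [AddCommGroup E] [Module ℝ E]
    [FiniteDimensional ℝ E] [AddCommGroup F] [Module ℝ F] (f : E →ₗ[ℝ] F)
    (S : Submodule ℝ E) :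
    finrank ℝ S = finrank ℝ (S.map f) + finrank ℝ ↥(S ⊓ LinearMap.ker f) := by
  rw [← (f.domRestrict S).finrank_range_add_finrank_ker, LinearMap.range_domRestrict,
    LinearMap.ker_domRestrict, ← finrank_map_subtype_eq, Submodule.map_comap_subtype]

lemma pushforward_apply (τ : 𝔤 →ₗ[ℝ] V →ₗ[ℝ] W) (ξ : V →ₗ[ℝ] 𝔤) (v : V) :
    pushforward τ ξ v = τ (ξ v) := rfl

lemma pushforward_eq_zero_iff {τ : 𝔤 →ₗ[ℝ] V →ₗ[ℝ] W} {ξ : V →ₗ[ℝ] 𝔤} :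
    pushforward τ ξ = 0 ↔ ∀ v, ξ v ∈ LinearMap.ker τ :=
  LinearMap.ext_iff

lemma map_pushforward_prolong_inf_vanishingOn (τ : 𝔤 →ₗ[ℝ] V →ₗ[ℝ] W) (Vk : Submodule ℝ V) :
    Submodule.map (pushforward τ) (tableauMapProlong τ ⊓ vanishingOn 𝔤 Vk) =
      tableauProlong (LinearMap.range τ) ⊓ vanishingOn (V →ₗ[ℝ] W) Vk := by
  apply le_antisymm
  · rintro _ ⟨ξ, ⟨hξ, h0⟩, rfl⟩
    refine ⟨⟨fun v => ⟨ξ v, rfl⟩, hξ⟩, fun v hv => ?_⟩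
    rw [pushforward_apply, h0 v hv, map_zero]
  · rintro η ⟨⟨hη, hsymm⟩, h0⟩
    obtain ⟨g, hg⟩ := τ.rangeRestrict.exists_rightInverse_of_surjective τ.range_rangeRestrict
    have hτ : ∀ v, τ (g ⟨η v, hη v⟩) = η v := fun v =>
      congrArg Subtype.val (LinearMap.congr_fun hg ⟨η v, hη v⟩)
    refine ⟨g ∘ₗ η.codRestrict _ hη, ⟨fun v w => ?_, fun v hv => ?_⟩, LinearMap.ext hτ⟩
    · change τ (g ⟨η v, hη v⟩) w = τ (g ⟨η w, hη w⟩) v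
      rw [hτ, hτ, hsymm]
    · have : η.codRestrict _ hη v = 0 := Subtype.ext (h0 v hv)
      rw [LinearMap.comp_apply, this, map_zero]

lemma prolong_inf_vanishingOn_inf_ker_pushforward (τ : 𝔤 →ₗ[ℝ] V →ₗ[ℝ] W)
    (Vk : Submodule ℝ V) :
    tableauMapProlong τ ⊓ vanishingOn 𝔤 Vk ⊓ LinearMap.ker (pushforward τ) =
      LinearMap.range (quotientHom Vk (LinearMap.ker τ)) := by
  ext ξ
  rw [mem_range_quotientHom, Submodule.mem_inf, LinearMap.mem_ker, pushforward_eq_zero_iff]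
  constructor
  · rintro ⟨⟨-, h0⟩, hK⟩
    exact ⟨hK, h0⟩
  · rintro ⟨hK, h0⟩
    refine ⟨⟨fun v w => ?_, h0⟩, hK⟩
    rw [LinearMap.mem_ker.1 (hK v), LinearMap.mem_ker.1 (hK w)]
    rfl

/-- the exact sequence `0 → Hom(V/V_k, ker τ) → (𝔤⁽¹⁾)_k → (𝔥⁽¹⁾)_k → 0`
and the resulting dimension count. -/
theorem tableauMap_prolong_flag_exact_sequence
    [FiniteDimensional ℝ 𝔤] [FiniteDimensional ℝ V] [FiniteDimensional ℝ W]
    {n : ℕ} (e : Basis (Fin n) ℝ V)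
    (τ : 𝔤 →ₗ[ℝ] V →ₗ[ℝ] W) (k : ℕ) (hk : k ≤ n) :
    Submodule.map (pushforward τ)
        (tableauMapProlong τ ⊓ vanishingOn 𝔤 (flagSub e k)) =
      tableauProlong (LinearMap.range τ) ⊓ vanishingOn (V →ₗ[ℝ] W) (flagSub e k) ∧
    (∀ ξ ∈ tableauMapProlong τ ⊓ vanishingOn 𝔤 (flagSub e k),
      (pushforward τ ξ = 0 ↔
        (∀ v, ξ v ∈ LinearMap.ker τ) ∧ ∀ v ∈ flagSub e k, ξ v = 0)) ∧
    finrank ℝ ↥(tableauMapProlong τ ⊓ vanishingOn 𝔤 (flagSub e k)) =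
      finrank ℝ ↥(tableauProlong (LinearMap.range τ) ⊓ vanishingOn (V →ₗ[ℝ] W) (flagSub e k)) +
        (n - k) * finrank ℝ (LinearMap.ker τ) := by
  refine ⟨map_pushforward_prolong_inf_vanishingOn τ _, fun ξ hξ => ?_, ?_⟩
  · rw [pushforward_eq_zero_iff]
    exact ⟨fun h => ⟨h, hξ.2⟩, fun h => h.1⟩
  · rw [finrank_eq_finrank_map_add_finrank_inf_ker (pushforward τ),
      map_pushforward_prolong_inf_vanishingOn, prolong_inf_vanishingOn_inf_ker_pushforward,
      finrank_range_quotientHom_flagSub e hk]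
end

section
/- (Cartan's bound for tableau maps.) Let τ : 𝔤 → Hom(V, W) be a tableau map with n = dim V. Then for any basis e₁,…,e_n of V, dim 𝔤⁽¹⁾ ≤ Σ_{k=0}^{n−1} dim 𝔤_k; equivalently, dim 𝔤⁽¹⁾ ≤ Σ_{k=1}^{n} k · s^𝔤_k, where the Cartan characters are s^𝔤_k = dim 𝔤_{k−1} − dim 𝔤_k for 1 ≤ k ≤ n−1 and s^𝔤_n = dim 𝔤_{n−1} (convention 𝔤_n := 0). -/
open Module Submodule

variable {𝔤 V W : Type} [AddCommGroup 𝔤] [Module ℝ 𝔤]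
  [AddCommGroup V] [Module ℝ V] [AddCommGroup W] [Module ℝ W]

/-- One step of Cartan's induction: evaluating at `v` the elements of the prolongation which
vanish on `U` gives values in the elements of the tableau which vanish on `U`. -/
theorem finrank_prolong_inf_vanishingOn_le [FiniteDimensional ℝ 𝔤] [FiniteDimensional ℝ V]
    (τ : 𝔤 →ₗ[ℝ] V →ₗ[ℝ] W) (U : Submodule ℝ V) (v : V) :
    finrank ℝ ↥(tableauMapProlong τ ⊓ vanishingOn 𝔤 U) ≤
      finrank ℝ ((vanishingOn W U).comap τ) +
        finrank ℝ ↥(tableauMapProlong τ ⊓ vanishingOn 𝔤 (U ⊔ span ℝ {v})) := by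
  set S := tableauMapProlong τ ⊓ vanishingOn 𝔤 U with hS
  let f : S →ₗ[ℝ] 𝔤 := (LinearMap.applyₗ v).domRestrict S
  rw [← f.finrank_range_add_finrank_ker]
  refine add_le_add (Submodule.finrank_mono ?_) ?_
  · rintro _ ⟨⟨ξ, hξ⟩, rfl⟩ u hu
    change τ (ξ v) u = 0
    rw [hξ.1 v u, hξ.2 u hu, map_zero, LinearMap.zero_apply]
  · rw [← Submodule.finrank_map_subtype_eq S (LinearMap.ker f)]
    refine Submodule.finrank_mono ?_
    rintro _ ⟨⟨ξ, hξ⟩, hker, rfl⟩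
    have hv : ξ v = 0 := hker
    refine ⟨hξ.1, fun x hx => ?_⟩
    obtain ⟨u, hu, w, hw, rfl⟩ := Submodule.mem_sup.1 hx
    obtain ⟨c, rfl⟩ := Submodule.mem_span_singleton.1 hw
    change ξ (u + c • v) = 0
    rw [map_add, map_smul, hv, hξ.2 u hu, smul_zero, add_zero]

theorem flagSub_mono {n : ℕ} (e : Basis (Fin n) ℝ V) : Monotone (flagSub e) :=
  fun _ _ h => Submodule.span_mono (Set.image_mono fun _ hi => lt_of_lt_of_le hi h)

theorem flagSub_succ_le {n : ℕ} (e : Basis (Fin n) ℝ V) (k : Fin n) :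
    flagSub e (k + 1) ≤ flagSub e k ⊔ span ℝ {e k} := by
  refine Submodule.span_le.2 ?_
  rintro _ ⟨i, hi, rfl⟩
  rcases (Nat.lt_succ_iff.1 hi).lt_or_eq with h | h
  · exact Submodule.mem_sup_left (Submodule.subset_span ⟨i, h, rfl⟩)
  · rw [Fin.ext h]
    exact Submodule.mem_sup_right (Submodule.mem_span_singleton_self _)

theorem flagSub_self {n : ℕ} (e : Basis (Fin n) ℝ V) : flagSub e n = ⊤ := by
  simp [flagSub, e.span_eq]

theorem vanishingOn_anti (M : Type) [AddCommGroup M] [Module ℝ M] :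
    Antitone (vanishingOn (V := V) M) :=
  fun _ _ h _ hξ v hv => hξ v (h hv)

theorem finrank_prolong_le_sum_add [FiniteDimensional ℝ 𝔤] [FiniteDimensional ℝ V]
    {n : ℕ} (e : Basis (Fin n) ℝ V) (τ : 𝔤 →ₗ[ℝ] V →ₗ[ℝ] W) {m : ℕ} (hm : m ≤ n) :
    finrank ℝ (tableauMapProlong τ) ≤
      ∑ k ∈ Finset.range m, finrank ℝ ((vanishingOn W (flagSub e k)).comap τ) +
        finrank ℝ ↥(tableauMapProlong τ ⊓ vanishingOn 𝔤 (flagSub e m)) := by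
  induction m with
  | zero =>
    have h : vanishingOn 𝔤 (flagSub e 0) = ⊤ := by
      refine eq_top_iff.2 fun ξ _ v hv => ?_
      have hv0 : v = 0 := by simpa [flagSub] using hv
      rw [hv0, map_zero]
    rw [h, inf_top_eq, Finset.sum_range_zero, zero_add]
  | succ m ih =>
    have h₁ := finrank_prolong_inf_vanishingOn_le τ (flagSub e m) (e ⟨m, hm⟩)
    have h₂ := Submodule.finrank_mono (inf_le_inf_left (tableauMapProlong τ)
      (vanishingOn_anti 𝔤 (flagSub_succ_le e ⟨m, hm⟩)))
    have h₃ := ih (Nat.le_of_succ_le hm)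
    rw [Finset.sum_range_succ]
    simp only at h₂
    lia

theorem sum_range_eq_sum_mul_sub {d : ℕ → ℕ} (hd : Antitone d) (m : ℕ) :
    ∑ k ∈ Finset.range (m + 1), d k =
      ∑ k ∈ Finset.range m, (k + 1) * (d k - d (k + 1)) + (m + 1) * d m := by
  induction m with
  | zero => simp
  | succ m ih =>
    rw [Finset.sum_range_succ, ih, Finset.sum_range_succ _ m]
    obtain ⟨c, hc⟩ := Nat.exists_eq_add_of_le (hd m.le_succ)
    rw [Nat.succ_eq_add_one] at hc
    rw [hc, Nat.add_sub_cancel_left]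
    ring

theorem sum_range_eq_sum_Icc_mul {d : ℕ → ℕ} (hd : Antitone d) (n : ℕ) :
    ∑ k ∈ Finset.range n, d k =
      ∑ k ∈ Finset.Icc 1 n, k * (if k = n then d (n - 1) else d (k - 1) - d k) := by
  cases n with
  | zero => simp
  | succ m =>
    rw [sum_range_eq_sum_mul_sub hd, Finset.sum_Icc_succ_top (by lia), if_pos rfl,
      ← Finset.Ico_add_one_right_eq_Icc, Finset.sum_Ico_eq_sum_range]
    refine congrArg₂ _ (Finset.sum_congr (by simp) fun k hk => ?_) (by simp)
    rw [if_neg (by have := Finset.mem_range.1 hk; lia), Nat.add_comm 1 k, Nat.add_sub_cancel]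

/-- Cartan's bound for tableau maps:
`dim 𝔤⁽¹⁾ ≤ Σ_{k=0}^{n−1} dim 𝔤_k`, equivalently `dim 𝔤⁽¹⁾ ≤ Σ_{k=1}^{n} k · s^𝔤_k`. -/
theorem tableauMap_cartan_bound
    [FiniteDimensional ℝ 𝔤] [FiniteDimensional ℝ V] [FiniteDimensional ℝ W]
    {n : ℕ} (e : Basis (Fin n) ℝ V)
    (τ : 𝔤 →ₗ[ℝ] V →ₗ[ℝ] W) :
    finrank ℝ (tableauMapProlong τ) ≤
      ∑ k ∈ Finset.range n, finrank ℝ ((vanishingOn W (flagSub e k)).comap τ) ∧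
    finrank ℝ (tableauMapProlong τ) ≤
      ∑ k ∈ Finset.Icc 1 n, k *
        (if k = n then finrank ℝ ((vanishingOn W (flagSub e (n - 1))).comap τ)
         else finrank ℝ ((vanishingOn W (flagSub e (k - 1))).comap τ) -
           finrank ℝ ((vanishingOn W (flagSub e k)).comap τ)) := by
  have h : finrank ℝ (tableauMapProlong τ) ≤
      ∑ k ∈ Finset.range n, finrank ℝ ((vanishingOn W (flagSub e k)).comap τ) := by
    have hbot : vanishingOn 𝔤 (flagSub e n) = ⊥ := by
      refine eq_bot_iff.2 fun ξ hξ => LinearMap.ext fun v => hξ v ?_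
      rw [flagSub_self]
      trivial
    have hle := finrank_prolong_le_sum_add e τ le_rfl
    rwa [hbot, inf_bot_eq, finrank_bot, add_zero] at hle
  refine ⟨h, h.trans_eq (sum_range_eq_sum_Icc_mul
    (d := fun k => finrank ℝ ((vanishingOn W (flagSub e k)).comap τ)) ?_ n)⟩
  exact fun _ _ hab => Submodule.finrank_mono
    (Submodule.comap_mono (vanishingOn_anti W (flagSub_mono e hab)))
end

section
/- Let τ : 𝔤 → Hom(V, W) be a tableau map with image 𝔥 = range τ, and fix a basis e₁,…,e_n of V with V_k = span(e₁,…,e_k). Then dim 𝔥⁽¹⁾ = Σ_{k=0}^{n−1} dim 𝔥_k holds if and only if dim 𝔤⁽¹⁾ = Σ_{k=0}^{n−1} dim 𝔤_k holds. -/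
open Module Submodule

variable {𝔤 V W : Type} [AddCommGroup 𝔤] [Module ℝ 𝔤]
  [AddCommGroup V] [Module ℝ V] [AddCommGroup W] [Module ℝ W]

/-- Rank-nullity for the preimage of a subspace. -/
lemma LinearMap.finrank_comap_eq {A B : Type} [AddCommGroup A] [Module ℝ A] [AddCommGroup B]
    [Module ℝ B] [FiniteDimensional ℝ A] (f : A →ₗ[ℝ] B) (S : Submodule ℝ B) :
    finrank ℝ (S.comap f) =
      finrank ℝ (LinearMap.ker f) + finrank ℝ ↥(LinearMap.range f ⊓ S) := by
  have h := (f.domRestrict (S.comap f)).finrank_range_add_finrank_ker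
  rw [LinearMap.range_domRestrict, Submodule.map_comap_eq, LinearMap.ker_domRestrict,
    (Submodule.comapSubtypeEquivOfLe
      (LinearMap.ker_le_comap f : LinearMap.ker f ≤ S.comap f)).finrank_eq] at h
  omega

/-- The kernel of `τ_*` is `Hom(V, ker τ)`. -/
lemma finrank_ker_pushforward [FiniteDimensional ℝ 𝔤] [FiniteDimensional ℝ V]
    (τ : 𝔤 →ₗ[ℝ] V →ₗ[ℝ] W) :
    finrank ℝ (LinearMap.ker (pushforward τ)) =
      finrank ℝ V * finrank ℝ (LinearMap.ker τ) := by
  let ι : (V →ₗ[ℝ] LinearMap.ker τ) →ₗ[ℝ] (V →ₗ[ℝ] 𝔤) :=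
    LinearMap.llcomp ℝ V (LinearMap.ker τ) 𝔤 (LinearMap.ker τ).subtype
  have hι : Function.Injective ι := fun a b h =>
    LinearMap.ext fun v => Subtype.ext (LinearMap.congr_fun h v)
  have hrange : LinearMap.range ι = LinearMap.ker (pushforward τ) := by
    ext ξ
    constructor
    · rintro ⟨a, rfl⟩
      exact LinearMap.ext fun v => (a v).2
    · intro h
      exact ⟨ξ.codRestrict _ fun v => LinearMap.congr_fun h v, rfl⟩
  rw [← hrange, LinearMap.finrank_range_of_inj hι, finrank_linearMap]

/-- The prolongation of `τ` is the preimage under `τ_*` of the prolongation of its range. -/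
lemma tableauMapProlong_eq_comap (τ : 𝔤 →ₗ[ℝ] V →ₗ[ℝ] W) :
    tableauMapProlong τ = (tableauProlong (LinearMap.range τ)).comap (pushforward τ) := by
  ext ξ
  exact ⟨fun h => ⟨fun v => ⟨ξ v, rfl⟩, h⟩, fun h => h.2⟩

/-- Every element of the prolongation of `range τ` lifts along `τ_*`. -/
lemma tableauProlong_range_le (τ : 𝔤 →ₗ[ℝ] V →ₗ[ℝ] W) :
    tableauProlong (LinearMap.range τ) ≤ LinearMap.range (pushforward τ) := by
  intro η hη
  obtain ⟨ξ, hξ⟩ := Module.projective_lifting_property τ.rangeRestrict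
    (η.codRestrict (LinearMap.range τ) hη.1) τ.surjective_rangeRestrict
  exact ⟨ξ, LinearMap.ext fun v => congrArg Subtype.val (LinearMap.congr_fun hξ v)⟩

/-- Cartan's bound is attained for `𝔥 = range τ` iff it is attained for
the tableau map `τ` itself. -/
theorem tableauMap_cartan_test_dim_iff
    [FiniteDimensional ℝ 𝔤] [FiniteDimensional ℝ V] [FiniteDimensional ℝ W]
    {n : ℕ} (e : Basis (Fin n) ℝ V)
    (τ : 𝔤 →ₗ[ℝ] V →ₗ[ℝ] W) :
    (finrank ℝ (tableauProlong (LinearMap.range τ)) =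
        ∑ k ∈ Finset.range n, finrank ℝ ↥(LinearMap.range τ ⊓ vanishingOn W (flagSub e k))) ↔
      (finrank ℝ (tableauMapProlong τ) =
        ∑ k ∈ Finset.range n, finrank ℝ ((vanishingOn W (flagSub e k)).comap τ)) := by
  rw [tableauMapProlong_eq_comap, LinearMap.finrank_comap_eq,
    inf_eq_right.mpr (tableauProlong_range_le τ), finrank_ker_pushforward,
    finrank_eq_card_basis e, Fintype.card_fin]
  simp_rw [LinearMap.finrank_comap_eq τ]
  rw [Finset.sum_add_distrib, Finset.sum_const, Finset.card_range, smul_eq_mul,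
    Nat.add_left_cancel_iff]
end

section
/- Let τ : 𝔤 → Hom(V, W) be a tableau map with image 𝔥 = range τ, and fix a basis e₁,…,e_n of V with V_k = span(e₁,…,e_k). Fix 1 ≤ k ≤ n. Then: (i) for every ξ ∈ (𝔤⁽¹⁾)_{k−1}, the element ξ(e_k) lies in 𝔤_{k−1}, and for every η ∈ (𝔥⁽¹⁾)_{k−1}, the element η(e_k) lies in 𝔥_{k−1}; (ii) the evaluation map ι_{e_k} : (𝔤⁽¹⁾)_{k−1} → 𝔤_{k−1}, ξ ↦ ξ(e_k), is surjective if and only if the evaluation map ι_{e_k} : (𝔥⁽¹⁾)_{k−1} → 𝔥_{k−1}, η ↦ η(e_k), is surjective. -/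
open Module Submodule

variable {𝔤 V W : Type} [AddCommGroup 𝔤] [Module ℝ 𝔤]
  [AddCommGroup V] [Module ℝ V] [AddCommGroup W] [Module ℝ W]

/-- A map `η : V → Hom(V, W)` with values in `range τ` vanishing on `V_j` lifts through `τ` to a map
vanishing on `V_j`, with any prescribed value at `e_j` lying over `η (e_j)`
(indices start at zero). -/
theorem exists_pushforward_eq_of_mem_vanishingOn {n : ℕ} (e : Basis (Fin n) ℝ V)
    (τ : 𝔤 →ₗ[ℝ] V →ₗ[ℝ] W) {η : V →ₗ[ℝ] V →ₗ[ℝ] W} (hη : ∀ v, η v ∈ LinearMap.range τ)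
    (j : Fin n) (hv : η ∈ vanishingOn (V →ₗ[ℝ] W) (flagSub e j)) {x : 𝔤} (hx : τ x = η (e j)) :
    ∃ ξ ∈ vanishingOn 𝔤 (flagSub e j), pushforward τ ξ = η ∧ ξ (e j) = x := by
  choose g hg using hη
  refine ⟨e.constr ℝ fun i => if i < j then 0 else if i = j then x else g (e i), ?_, ?_, ?_⟩
  · intro v hvj
    refine (Submodule.span_le (p := LinearMap.ker _)).mpr ?_ hvj
    rintro _ ⟨i, hi, rfl⟩
    have hij : i < j := hi
    rw [SetLike.mem_coe, LinearMap.mem_ker, Basis.constr_basis, if_pos hij]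
  · refine e.ext fun i => ?_
    simp only [pushforward, LinearMap.llcomp_apply, Basis.constr_basis]
    split_ifs with hlt heq
    · rw [map_zero, hv _ (Submodule.subset_span ⟨i, hlt, rfl⟩)]
    · rw [heq, hx]
    · exact hg _
  · rw [Basis.constr_basis, if_neg (lt_irrefl j), if_pos rfl]

/-- evaluation at `e_k` maps `(𝔤⁽¹⁾)_{k−1}` into `𝔤_{k−1}` and
`(𝔥⁽¹⁾)_{k−1}` into `𝔥_{k−1}`, and one evaluation map is surjective iff the other is. -/
theorem tableauMap_evaluation_surjective_iff
    [FiniteDimensional ℝ 𝔤] [FiniteDimensional ℝ V] [FiniteDimensional ℝ W]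
    {n : ℕ} (e : Basis (Fin n) ℝ V)
    (τ : 𝔤 →ₗ[ℝ] V →ₗ[ℝ] W) (k : ℕ) (hk1 : 1 ≤ k) (hkn : k ≤ n) :
    (∀ ξ ∈ tableauMapProlong τ ⊓ vanishingOn 𝔤 (flagSub e (k - 1)),
        ξ (e ⟨k - 1, by omega⟩) ∈ (vanishingOn W (flagSub e (k - 1))).comap τ) ∧
    (∀ η ∈ tableauProlong (LinearMap.range τ) ⊓ vanishingOn (V →ₗ[ℝ] W) (flagSub e (k - 1)),
        η (e ⟨k - 1, by omega⟩) ∈ LinearMap.range τ ⊓ vanishingOn W (flagSub e (k - 1))) ∧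
    ((∀ x ∈ (vanishingOn W (flagSub e (k - 1))).comap τ,
        ∃ ξ ∈ tableauMapProlong τ ⊓ vanishingOn 𝔤 (flagSub e (k - 1)),
          ξ (e ⟨k - 1, by omega⟩) = x) ↔
      (∀ A ∈ LinearMap.range τ ⊓ vanishingOn W (flagSub e (k - 1)),
        ∃ η ∈ tableauProlong (LinearMap.range τ) ⊓ vanishingOn (V →ₗ[ℝ] W) (flagSub e (k - 1)),
          η (e ⟨k - 1, by omega⟩) = A)) := by
  refine ⟨fun ξ hξ v hv => ?_, fun η hη => ⟨hη.1.1 _, fun v hv => ?_⟩, fun h => ?_, fun h => ?_⟩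
  · rw [hξ.1 _ v, hξ.2 v hv, map_zero, LinearMap.zero_apply]
  · rw [hη.1.2 _ v, hη.2 v hv, LinearMap.zero_apply]
  · rintro _ ⟨⟨x, rfl⟩, hA⟩
    obtain ⟨ξ, ⟨hξ, hv⟩, rfl⟩ := h x hA
    refine ⟨pushforward τ ξ, ⟨⟨fun v => ⟨ξ v, rfl⟩, hξ⟩, fun v hv' => ?_⟩, rfl⟩
    simp [pushforward, hv v hv']
  · intro x hx
    obtain ⟨η, ⟨⟨hr, hs⟩, hv⟩, hηx⟩ := h (τ x) ⟨⟨x, rfl⟩, hx⟩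
    obtain ⟨ξ, hξ, rfl, hξx⟩ := exists_pushforward_eq_of_mem_vanishingOn e τ hr
      ⟨k - 1, by omega⟩ hv hηx.symm
    exact ⟨ξ, ⟨hs, hξ⟩, hξx⟩
end

section
/- (Cartan's test for tableau maps.) Let τ : 𝔤 → Hom(V, W) be a tableau map with image 𝔥 = range τ, and fix a basis e₁,…,e_n of V with V_k = span(e₁,…,e_k). Then the following are equivalent: (1) dim 𝔥⁽¹⁾ = Σ_{k=0}^{n−1} dim 𝔥_k; (2) dim 𝔤⁽¹⁾ = Σ_{k=0}^{n−1} dim 𝔤_k; (3) for every 1 ≤ k ≤ n, the evaluation map (𝔥⁽¹⁾)_{k−1} → 𝔥_{k−1}, η ↦ η(e_k), is surjective; (4) for every 1 ≤ k ≤ n, the evaluation map (𝔤⁽¹⁾)_{k−1} → 𝔤_{k−1}, ξ ↦ ξ(e_k), is surjective. -/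
open Module Submodule

variable {𝔤 V W : Type} [AddCommGroup 𝔤] [Module ℝ 𝔤]
  [AddCommGroup V] [Module ℝ V] [AddCommGroup W] [Module ℝ W]

theorem mem_vanishingOn_flagSub_iff {M : Type} [AddCommGroup M] [Module ℝ M] {n : ℕ}
    (e : Basis (Fin n) ℝ V) (k : ℕ) (ξ : V →ₗ[ℝ] M) :
    ξ ∈ vanishingOn M (flagSub e k) ↔ ∀ i : Fin n, (i : ℕ) < k → ξ (e i) = 0 := by
  change flagSub e k ≤ LinearMap.ker ξ ↔ _
  rw [flagSub, Submodule.span_le, Set.image_subset_iff]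
  rfl

theorem vanishingOn_flagSub_zero (M : Type) [AddCommGroup M] [Module ℝ M] {n : ℕ}
    (e : Basis (Fin n) ℝ V) : vanishingOn M (flagSub e 0) = ⊤ := by
  ext ξ
  simp [mem_vanishingOn_flagSub_iff]

theorem vanishingOn_flagSub_self (M : Type) [AddCommGroup M] [Module ℝ M] {n : ℕ}
    (e : Basis (Fin n) ℝ V) : vanishingOn M (flagSub e n) = ⊥ := by
  ext ξ
  rw [mem_vanishingOn_flagSub_iff, Submodule.mem_bot]
  refine ⟨fun h => e.ext fun i => by simpa using h i i.isLt, fun h => by simp [h]⟩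

theorem vanishingOn_flagSub_succ (M : Type) [AddCommGroup M] [Module ℝ M] {n : ℕ}
    (e : Basis (Fin n) ℝ V) (k : Fin n) :
    vanishingOn M (flagSub e (k + 1)) =
      vanishingOn M (flagSub e k) ⊓ LinearMap.ker (LinearMap.applyₗ (R := ℝ) (M₂ := M) (e k)) := by
  ext ξ
  simp only [Submodule.mem_inf, mem_vanishingOn_flagSub_iff, LinearMap.mem_ker,
    LinearMap.applyₗ_apply_apply]
  refine ⟨fun h => ⟨fun i hi => h i (by omega), h k (by omega)⟩, fun ⟨h, hk⟩ i hi => ?_⟩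
  rcases Nat.lt_succ_iff_lt_or_eq.mp hi with hi | hi
  · exact h i hi
  · rwa [Fin.ext hi]

/-- If the flag `P ⊓ Hom(V / V_k, M)` has evaluations at `e_{k+1}` landing in `Q k`, then
`dim P` attains the bound `∑ dim (Q k)` if and only if all of these evaluations are onto. -/
theorem finrank_eq_sum_iff_evaluation_surjective {M : Type} [AddCommGroup M] [Module ℝ M]
    [FiniteDimensional ℝ V] [FiniteDimensional ℝ M] {n : ℕ} (e : Basis (Fin n) ℝ V)
    (P : Submodule ℝ (V →ₗ[ℝ] M)) (Q : ℕ → Submodule ℝ M)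
    (hPQ : ∀ k : Fin n, ∀ ξ ∈ P ⊓ vanishingOn M (flagSub e k), ξ (e k) ∈ Q k) :
    finrank ℝ P = ∑ k ∈ Finset.range n, finrank ℝ (Q k) ↔
      ∀ k : Fin n, ∀ x ∈ Q k, ∃ ξ ∈ P ⊓ vanishingOn M (flagSub e k), ξ (e k) = x := by
  let F : ℕ → Submodule ℝ (V →ₗ[ℝ] M) := fun k => P ⊓ vanishingOn M (flagSub e k)
  let ev : Fin n → (V →ₗ[ℝ] M) →ₗ[ℝ] M := fun k => LinearMap.applyₗ (e k)
  have hle : ∀ k : Fin n, (F k).map (ev k) ≤ Q k := by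
    rintro k _ ⟨ξ, hξ, rfl⟩
    exact hPQ k ξ hξ
  have hstep : ∀ k : Fin n,
      finrank ℝ (F k) = finrank ℝ ((F k).map (ev k)) + finrank ℝ (F (k + 1)) := by
    intro k
    have hker : finrank ℝ (LinearMap.ker ((ev k).domRestrict (F k))) = finrank ℝ (F (k + 1)) := by
      have hF : F (k + 1) = F k ⊓ LinearMap.ker (ev k) := by
        simp only [F, ev, vanishingOn_flagSub_succ, inf_assoc]
      rw [LinearMap.ker_domRestrict, ← Submodule.finrank_map_subtype_eq,
        Submodule.map_comap_subtype, hF]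
    rw [← LinearMap.finrank_range_add_finrank_ker ((ev k).domRestrict (F k)), hker,
      LinearMap.range_domRestrict]
  have htel : ∀ m (hm : m ≤ n), finrank ℝ (F 0) =
      ∑ k : Fin m, finrank ℝ ((F k).map (ev (k.castLE hm))) + finrank ℝ (F m) := by
    intro m
    induction m with
    | zero => simp
    | succ m ih =>
      intro hm
      rw [ih (by omega), Fin.sum_univ_castSucc, hstep ⟨m, hm⟩, add_assoc]
      rfl
  have hsum : finrank ℝ P = ∑ k : Fin n, finrank ℝ ((F k).map (ev k)) := by
    have hF0 : F 0 = P := by simp only [F, vanishingOn_flagSub_zero, inf_top_eq]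
    have hFn : F n = ⊥ := by simp only [F, vanishingOn_flagSub_self, inf_bot_eq]
    have h := htel n le_rfl
    rwa [hF0, hFn, finrank_bot, add_zero] at h
  rw [hsum, Finset.sum_range, Finset.sum_eq_sum_iff_of_le
    fun k _ => Submodule.finrank_mono (hle k)]
  constructor
  · intro h k x hx
    rw [← Submodule.eq_of_le_of_finrank_eq (hle k) (h k (Finset.mem_univ k))] at hx
    exact hx
  · intro h k _
    refine congrArg (fun S : Submodule ℝ M => finrank ℝ S) (le_antisymm (hle k) fun x hx => ?_)
    exact h k x hx

/-- A prescribed value at one basis vector extends to a lift along `τ` that stays in the flag. -/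
theorem exists_lift_vanishingOn_flagSub {n : ℕ} (e : Basis (Fin n) ℝ V)
    (τ : 𝔤 →ₗ[ℝ] V →ₗ[ℝ] W) (k : Fin n) (η : V →ₗ[ℝ] V →ₗ[ℝ] W)
    (hη : ∀ v, η v ∈ LinearMap.range τ) (hk : η ∈ vanishingOn (V →ₗ[ℝ] W) (flagSub e k))
    (x : 𝔤) (hx : η (e k) = τ x) :
    ∃ ξ ∈ vanishingOn 𝔤 (flagSub e k), τ ∘ₗ ξ = η ∧ ξ (e k) = x := by
  rw [mem_vanishingOn_flagSub_iff] at hk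
  have hlift : ∀ i : Fin n, ∃ y : 𝔤, τ y = η (e i) ∧ (i < k → y = 0) ∧ (i = k → y = x) := by
    intro i
    rcases lt_trichotomy i k with h | h | h
    · exact ⟨0, by simp [hk i h], fun _ => rfl, fun h' => absurd h' h.ne⟩
    · exact ⟨x, by rw [h, hx], fun h' => absurd h h'.ne, fun _ => rfl⟩
    · obtain ⟨y, hy⟩ := hη (e i)
      exact ⟨y, hy, fun h' => absurd h' h.asymm, fun h' => absurd h' h.ne'⟩
  choose y hy hy0 hyx using hlift
  refine ⟨e.constr ℝ y, ?_, e.ext fun i => by simp [hy], by simp [hyx]⟩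
  rw [mem_vanishingOn_flagSub_iff]
  intro i hi
  rw [Basis.constr_basis, hy0 i hi]

/-- Cartan's test for tableau maps: the four conditions are equivalent. -/
theorem tableauMap_cartan_test
    [FiniteDimensional ℝ 𝔤] [FiniteDimensional ℝ V] [FiniteDimensional ℝ W]
    {n : ℕ} (e : Basis (Fin n) ℝ V)
    (τ : 𝔤 →ₗ[ℝ] V →ₗ[ℝ] W) :
    [ finrank ℝ (tableauProlong (LinearMap.range τ)) =
        ∑ k ∈ Finset.range n, finrank ℝ ↥(LinearMap.range τ ⊓ vanishingOn W (flagSub e k)),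
      finrank ℝ (tableauMapProlong τ) =
        ∑ k ∈ Finset.range n, finrank ℝ ((vanishingOn W (flagSub e k)).comap τ),
      ∀ (k : ℕ) (hk1 : 1 ≤ k) (hkn : k ≤ n),
        ∀ A ∈ LinearMap.range τ ⊓ vanishingOn W (flagSub e (k - 1)),
          ∃ η ∈ tableauProlong (LinearMap.range τ) ⊓ vanishingOn (V →ₗ[ℝ] W) (flagSub e (k - 1)),
            η (e ⟨k - 1, by omega⟩) = A,
      ∀ (k : ℕ) (hk1 : 1 ≤ k) (hkn : k ≤ n),
        ∀ x ∈ (vanishingOn W (flagSub e (k - 1))).comap τ,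
          ∃ ξ ∈ tableauMapProlong τ ⊓ vanishingOn 𝔤 (flagSub e (k - 1)),
            ξ (e ⟨k - 1, by omega⟩) = x ].TFAE := by
  tfae_have 1 ↔ 3 := by
    refine (finrank_eq_sum_iff_evaluation_surjective e _
      (fun k => LinearMap.range τ ⊓ vanishingOn W (flagSub e k)) ?_).trans
      ⟨fun h k _ _ => h ⟨k - 1, by omega⟩, fun h k => h (k + 1) k.val.succ_pos k.isLt⟩
    rintro k η ⟨⟨hη, hsymm⟩, hk⟩
    refine ⟨hη _, fun v hv => ?_⟩
    rw [hsymm, hk v hv, LinearMap.zero_apply]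
  tfae_have 2 ↔ 4 := by
    refine (finrank_eq_sum_iff_evaluation_surjective e _
      (fun k => (vanishingOn W (flagSub e k)).comap τ) ?_).trans
      ⟨fun h k _ _ => h ⟨k - 1, by omega⟩, fun h k => h (k + 1) k.val.succ_pos k.isLt⟩
    rintro k ξ ⟨hsymm, hk⟩ v hv
    rw [hsymm, hk v hv, map_zero, LinearMap.zero_apply]
  tfae_have 3 → 4 := by
    intro h k hk1 hkn x hx
    obtain ⟨η, ⟨⟨hη, hsymm⟩, hk⟩, hηx⟩ := h k hk1 hkn (τ x) ⟨⟨x, rfl⟩, hx⟩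
    obtain ⟨ξ, hξ, rfl, hξx⟩ :=
      exists_lift_vanishingOn_flagSub e τ ⟨k - 1, by omega⟩ η hη hk x hηx
    exact ⟨ξ, ⟨hsymm, hξ⟩, hξx⟩
  tfae_have 4 → 3 := by
    rintro h k hk1 hkn _ ⟨⟨x, rfl⟩, hx⟩
    obtain ⟨ξ, ⟨hsymm, hξ⟩, rfl⟩ := h k hk1 hkn x hx
    exact ⟨τ ∘ₗ ξ, ⟨⟨fun v => ⟨ξ v, rfl⟩, hsymm⟩, fun v hv => by simp [hξ v hv]⟩, rfl⟩
  tfae_finish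
end

section
/- Let p : C → E be a surjective linear map between finite-dimensional real vector spaces with E ≠ 0, and let S = {h ∈ Hom(E, C) | p ∘ h = id_E} be the set of linear splittings of p, equipped with the subspace topology from Hom(E, C). Then for every nonempty open subset U of S, the union ⋃_{h ∈ U} range(h) spans C. -/
open Module Submodule

/-- for a surjective linear map `p : C → E` with `E ≠ 0`, and any nonempty
relatively open subset of the affine space `S` of linear splittings of `p` (a relatively
open subset being `S ∩ U` for an open `U` of `Hom(E, C)`), the union of the ranges of its
elements spans `C`. -/
theorem splittings_open_subset_spans
    {C E : Type} [NormedAddCommGroup C] [NormedSpace ℝ C] [FiniteDimensional ℝ C]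
    [NormedAddCommGroup E] [NormedSpace ℝ E] [FiniteDimensional ℝ E] [Nontrivial E]
    (p : C →ₗ[ℝ] E) (hp : Function.Surjective p)
    (U : Set (E →L[ℝ] C)) (hU : IsOpen U)
    (hne : ({h : E →L[ℝ] C | ∀ x, p (h x) = x} ∩ U).Nonempty) :
    Submodule.span ℝ (⋃ h ∈ {h : E →L[ℝ] C | ∀ x, p (h x) = x} ∩ U, Set.range ⇑h) = ⊤ := by
  obtain ⟨h₀, hs, hu⟩ := hne
  set W := Submodule.span ℝ (⋃ h ∈ {h : E →L[ℝ] C | ∀ x, p (h x) = x} ∩ U, Set.range ⇑h)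
  have apply_mem : ∀ h ∈ {h : E →L[ℝ] C | ∀ x, p (h x) = x} ∩ U, ∀ x, h x ∈ W :=
    fun h hh x ↦ Submodule.subset_span (Set.mem_biUnion hh (Set.mem_range_self x))
  have ker_le : ∀ k, p k = 0 → k ∈ W := by
    intro k hk
    obtain ⟨e, he⟩ := exists_ne (0 : E)
    obtain ⟨f, hf⟩ := SeparatingDual.exists_eq_one (R := ℝ) he
    have hcont : Continuous fun t : ℝ ↦ h₀ + t • f.smulRight k := by fun_prop
    have hev : ∀ᶠ t : ℝ in nhds 0, h₀ + t • f.smulRight k ∈ U :=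
      hcont.continuousAt.eventually_mem (hU.mem_nhds (by simpa using hu))
    obtain ⟨t, htU, ht⟩ :=
      ((hev.filter_mono nhdsWithin_le_nhds).and
        (self_mem_nhdsWithin : {0}ᶜ ∈ nhdsWithin (0 : ℝ) {0}ᶜ)).exists
    have hmem := W.sub_mem (apply_mem _ ⟨fun x ↦ by simp [hs x, hk], htU⟩ e)
      (apply_mem h₀ ⟨hs, hu⟩ e)
    have htk : t • k ∈ W := by simpa [hf] using hmem
    exact (W.smul_mem_iff ht).1 htk
  refine eq_top_iff.2 fun c _ ↦ ?_
  have hc := W.add_mem (apply_mem h₀ ⟨hs, hu⟩ (p c))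
    (ker_le (c - h₀ (p c)) (by rw [map_sub, hs, sub_self]))
  rwa [add_sub_cancel] at hc
end

section
/- Let p : C → E be a surjective linear map between finite-dimensional real vector spaces, K = ker p, and let 𝔊 ⊆ Hom(E, K) be a linear subspace such that for some e ∈ E the evaluation map 𝔊 → K, ξ ↦ ξ(e), is surjective. Let h₀ be a linear splitting of p (p ∘ h₀ = id_E) and let A = {h₀ + ξ | ξ ∈ 𝔊}, equipped with the subspace topology from Hom(E, C). Then for every nonempty open subset U of A, the union ⋃_{h ∈ U} range(h) spans C. -/
open Module Submodule

theorem IsOpen.exists_ne_zero_add_smul_mem {V : Type*} [AddCommGroup V] [Module ℝ V]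
    [TopologicalSpace V] [ContinuousAdd V] [ContinuousSMul ℝ V] {U : Set V} (hU : IsOpen U)
    {x : V} (hx : x ∈ U) (v : V) : ∃ t : ℝ, t ≠ 0 ∧ x + t • v ∈ U := by
  have hc : Continuous fun t : ℝ => x + t • v := by fun_prop
  have h : ∀ᶠ t in nhdsWithin (0 : ℝ) {0}ᶜ, x + t • v ∈ U :=
    nhdsWithin_le_nhds ((hU.preimage hc).mem_nhds (by simpa using hx))
  obtain ⟨t, ht, ht0⟩ := (h.and self_mem_nhdsWithin).exists
  exact ⟨t, ht0, ht⟩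

/-- let `p : C → E` be surjective with kernel `K`, `𝔊 ⊆ Hom(E, K)` a subspace
such that evaluation at some `e ∈ E` maps `𝔊` onto `K`, and `h₀` a splitting of `p`. Then for
any nonempty relatively open subset of the affine space `A = h₀ + 𝔊` (a relatively open subset
being `A ∩ U` for an open `U` of `Hom(E, C)`), the union of the ranges of its elements
spans `C`. -/
theorem affine_splittings_open_subset_spans
    {C E : Type} [NormedAddCommGroup C] [NormedSpace ℝ C] [FiniteDimensional ℝ C]
    [NormedAddCommGroup E] [NormedSpace ℝ E] [FiniteDimensional ℝ E]
    (p : C →ₗ[ℝ] E) (hp : Function.Surjective p)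
    (𝔊 : Submodule ℝ (E →L[ℝ] C)) (h𝔊 : ∀ ξ ∈ 𝔊, ∀ x, p (ξ x) = 0)
    (hev : ∃ e : E, ∀ k ∈ LinearMap.ker p, ∃ ξ ∈ 𝔊, ξ e = k)
    (h₀ : E →L[ℝ] C) (hh₀ : ∀ x, p (h₀ x) = x)
    (U : Set (E →L[ℝ] C)) (hU : IsOpen U)
    (hne : (((fun ξ => h₀ + ξ) '' ↑𝔊) ∩ U).Nonempty) :
    Submodule.span ℝ (⋃ h ∈ ((fun ξ => h₀ + ξ) '' ↑𝔊) ∩ U, Set.range ⇑h) = ⊤ := by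
  obtain ⟨e, he⟩ := hev
  obtain ⟨_, ⟨η, hη, rfl⟩, hηU⟩ := hne
  set S := Submodule.span ℝ (⋃ h ∈ ((fun ξ => h₀ + ξ) '' ↑𝔊) ∩ U, Set.range ⇑h)
  have mem_S : ∀ ξ ∈ 𝔊, h₀ + ξ ∈ U → ∀ x, (h₀ + ξ) x ∈ S := fun ξ hξ hU x =>
    Submodule.subset_span (Set.mem_biUnion ⟨⟨ξ, hξ, rfl⟩, hU⟩ ⟨x, rfl⟩)
  have ker_le : LinearMap.ker p ≤ S := by
    intro k hk
    obtain ⟨ξ, hξ, rfl⟩ := he k hk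
    obtain ⟨t, ht, htU⟩ := hU.exists_ne_zero_add_smul_mem hηU ξ
    have h₁ := mem_S (η + t • ξ) (𝔊.add_mem hη (𝔊.smul_mem t hξ)) (by rwa [← add_assoc]) e
    have h₂ := S.sub_mem h₁ (mem_S η hη hηU e)
    have h₃ : (h₀ + (η + t • ξ)) e - (h₀ + η) e = t • ξ e := by
      simp only [add_apply, smul_apply]
      abel
    rw [h₃] at h₂
    exact (S.smul_mem_iff ht).1 h₂
  refine eq_top_iff.2 fun c _ => ?_
  have hk : c - (h₀ + η) (p c) ∈ LinearMap.ker p := by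
    simp [LinearMap.mem_ker, hh₀, h𝔊 η hη]
  simpa using S.add_mem (ker_le hk) (mem_S η hη hηU (p c))
end
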